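/- arXiv:1206.2541 — 5 statements merged into one kernel-verified Lean document; each statement's English description precedes it below -/
import Mathlib

section
/- Let g ≥ 2. Let u, v : ℝ^{2g} → ℝ³ be linear maps such that u is surjective, [u∧u] = 0, [u∧v] = 0, and Q_{u,v}(x,y) = 0 for all x, y ∈ ℝ^{2g}. Then there exists ξ ∈ ℝ³ such that v(x) = ξ × u(x) for all x ∈ ℝ^{2g}. -/
open Matrix

/-- The `i`-th standard symplectic basis vector `e_i` of `ℝ^{2g}` (for `i < g`). -/
def eVec (g : ℕ) (i : Fin g) : Fin (2 * g) → ℝ :=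
  Pi.single ⟨i.1, by have := i.2; omega⟩ 1

/-- The `i`-th standard symplectic basis vector `f_i = e_{g+i}` of `ℝ^{2g}`. -/
def fVec (g : ℕ) (i : Fin g) : Fin (2 * g) → ℝ :=
  Pi.single ⟨g + i.1, by have := i.2; omega⟩ 1

/-- The bracket `[u ∧ v] = Σᵢ (u(eᵢ) × v(fᵢ) − u(fᵢ) × v(eᵢ)) ∈ ℝ³`, with `su(2)`
identified with `(ℝ³, ×)`. -/
def wedgeBracket (g : ℕ) (u v : (Fin (2 * g) → ℝ) →ₗ[ℝ] (Fin 3 → ℝ)) : Fin 3 → ℝ :=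
  ∑ i : Fin g,
    (crossProduct (u (eVec g i)) (v (fVec g i)) - crossProduct (u (fVec g i)) (v (eVec g i)))

/-- `Q_{u,v}(x,y) = ⟨u(x) × u(y), u(x) × v(y) − u(y) × v(x)⟩`. -/
def Quv (g : ℕ) (u v : (Fin (2 * g) → ℝ) →ₗ[ℝ] (Fin 3 → ℝ)) (x y : Fin (2 * g) → ℝ) : ℝ :=
  (crossProduct (u x) (u y)) ⬝ᵥ (crossProduct (u x) (v y) - crossProduct (u y) (v x))

/-- If `u` is onto and `Q_{u,v}` vanishes, then `v` vanishes on the kernel of `u`. -/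
theorem eq_zero_of_Quv_eq_zero {g : ℕ} {u v : (Fin (2 * g) → ℝ) →ₗ[ℝ] (Fin 3 → ℝ)}
    (hu : Function.Surjective u) (hQ : ∀ x y : Fin (2 * g) → ℝ, Quv g u v x y = 0)
    {k : Fin (2 * g) → ℝ} (hk : u k = 0) : v k = 0 := by
  obtain ⟨p, hp⟩ := hu ![1, 0, 0]
  obtain ⟨q, hq⟩ := hu ![0, 1, 0]
  obtain ⟨r, hr⟩ := hu ![0, 0, 1]
  have h₀ := hQ (p + k) q
  have h₀' := hQ p q
  have h₁ := hQ (q + k) r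
  have h₁' := hQ q r
  have h₂ := hQ (r + k) p
  have h₂' := hQ r p
  simp [Quv, map_add, hp, hq, hr, hk, cross_apply, dotProduct, Fin.sum_univ_three]
    at h₀ h₀' h₁ h₁' h₂ h₂'
  ext i
  fin_cases i <;> simp <;> linarith

/-- Lemma 4.2: if `u` is surjective, `[u∧u] = 0`, `[u∧v] = 0` and `Q_{u,v} ≡ 0`, then
`v = [ξ, u]` for some `ξ ∈ ℝ³`. -/
theorem stmt0 (g : ℕ) (hg : 2 ≤ g) (u v : (Fin (2 * g) → ℝ) →ₗ[ℝ] (Fin 3 → ℝ))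
    (hu : Function.Surjective u)
    (huu : wedgeBracket g u u = 0)
    (huv : wedgeBracket g u v = 0)
    (hQ : ∀ x y : Fin (2 * g) → ℝ, Quv g u v x y = 0) :
    ∃ ξ : Fin 3 → ℝ, ∀ x : Fin (2 * g) → ℝ, v x = crossProduct ξ (u x) := by
  obtain ⟨p, hp⟩ := hu ![1, 0, 0]
  obtain ⟨q, hq⟩ := hu ![0, 1, 0]
  obtain ⟨r, hr⟩ := hu ![0, 0, 1]
  have hv (x : Fin (2 * g) → ℝ) : v x = u x 0 • v p + u x 1 • v q + u x 2 • v r := by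
    have hk : u (x - (u x 0 • p + u x 1 • q + u x 2 • r)) = 0 := by
      ext i
      fin_cases i <;> simp [hp, hq, hr]
    have h := eq_zero_of_Quv_eq_zero hu hQ hk
    rw [map_sub, sub_eq_zero] at h
    simpa using h
  have hpq := hQ p q
  have hqr := hQ q r
  have hrp := hQ r p
  have hpqr := hQ (p + q) r
  have hqrp := hQ (q + r) p
  have hrpq := hQ (r + p) q
  simp [Quv, map_add, hp, hq, hr, cross_apply, dotProduct, Fin.sum_univ_three]
    at hpq hqr hrp hpqr hqrp hrpq
  have hp₀ : v p 0 = 0 := by linarith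
  have hq₁ : v q 1 = 0 := by linarith
  have hr₂ : v r 2 = 0 := by linarith
  have hq₀ : v q 0 = -v p 1 := by linarith
  have hr₁ : v r 1 = -v q 2 := by linarith
  have hr₀ : v r 0 = -v p 2 := by linarith
  refine ⟨![v q 2, -v p 2, v p 1], fun x => ?_⟩
  rw [hv x]
  ext i
  fin_cases i <;> simp [cross_apply, hp₀, hq₁, hr₂, hq₀, hr₁, hr₀] <;> ring
end

section
/- Let g ≥ 1 and set N = g(2g+1)(2g²+g+1)/2. There exist N pairs (x_1,y_1), …, (x_N,y_N) of integer vectors x_i, y_i ∈ ℤ^{2g} with ω(x_i,y_i) = 1 such that: every quadratic form Q on the space of real 2g×2g matrices satisfying Q(x_i y_iᵀ + y_i x_iᵀ) = 0 for all 1 ≤ i ≤ N also satisfies Q(x yᵀ + y xᵀ) = 0 for all x, y ∈ ℝ^{2g}. -/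
open Matrix

/-- The standard symplectic form `ω(x,y) = Σᵢ (xᵢ y_{g+i} − x_{g+i} yᵢ)` on `ℤ^{2g}`. -/
def omegaInt (g : ℕ) (x y : Fin (2 * g) → ℤ) : ℤ :=
  ∑ i : Fin g,
    (x ⟨i.1, by have := i.2; omega⟩ * y ⟨g + i.1, by have := i.2; omega⟩ -
      x ⟨g + i.1, by have := i.2; omega⟩ * y ⟨i.1, by have := i.2; omega⟩)

theorem exists_fin_span_range_eq {K E P : Type*} [Field K] [AddCommGroup E] [Module K E]
    [FiniteDimensional K E] [Nonempty P] (u : P → E) {N : ℕ} (hN : Module.finrank K E ≤ N) :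
    ∃ S : Fin N → P, ∀ p, u p ∈ Submodule.span K (Set.range (u ∘ S)) := by
  obtain ⟨f, hf, hspan, -⟩ := Submodule.exists_fun_fin_finrank_span_eq K (Set.range u)
  choose a ha using hf
  have hle := (Submodule.finrank_le (Submodule.span K (Set.range u))).trans hN
  refine ⟨fun i => if h : i.1 < Module.finrank K (Submodule.span K (Set.range u)) then
    a ⟨i.1, h⟩ else Classical.arbitrary P, fun p => ?_⟩
  have hp : u p ∈ Submodule.span K (Set.range f) :=
    hspan.symm ▸ Submodule.subset_span (Set.mem_range_self (f := u) p)
  refine Submodule.span_mono ?_ hp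
  rintro _ ⟨i, rfl⟩
  exact ⟨Fin.castLE hle i, by simp [ha]⟩

/-- A family of vectors can be thinned to `card (Sym2 κ)` members that impose the same
conditions on quadratic forms. -/
theorem QuadraticForm.exists_fin_eq_zero {κ P : Type*} [Fintype κ] [DecidableEq κ] [Nonempty P]
    (v : P → κ → ℝ) {N : ℕ} (hN : Fintype.card (Sym2 κ) ≤ N) :
    ∃ S : Fin N → P, ∀ q : QuadraticForm ℝ (κ → ℝ),
      (∀ i, q (v (S i)) = 0) → ∀ p, q (v p) = 0 := by
  obtain ⟨S, hS⟩ := exists_fin_span_range_eq (K := ℝ)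
    (fun p (s : Sym2 κ) => (s.map (v p)).mul) (N := N) (by simpa using hN)
  refine ⟨S, fun q hq p => ?_⟩
  let A := LinearMap.BilinForm.toMatrix' (QuadraticMap.associated (R := ℝ) q)
  let L : (Sym2 κ → ℝ) →ₗ[ℝ] ℝ := ∑ i, ∑ j, A i j • LinearMap.proj s(i, j)
  have hL : ∀ w : κ → ℝ, L (fun s => (s.map w).mul) = q w := by
    intro w
    have h1 : q w = Matrix.toBilin' A w w := by
      rw [Matrix.toBilin'_toMatrix', QuadraticMap.associated_eq_self_apply]
    rw [h1, Matrix.toBilin'_apply]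
    simp only [L, LinearMap.sum_apply, LinearMap.smul_apply, LinearMap.proj_apply, Sym2.map_mk,
      Sym2.mul_mk, smul_eq_mul]
    exact Finset.sum_congr rfl fun i _ => Finset.sum_congr rfl fun j _ => by ring
  rw [← hL]
  have hle : Submodule.span ℝ (Set.range ((fun p (s : Sym2 κ) => (s.map (v p)).mul) ∘ S)) ≤
      LinearMap.ker L := by
    rw [Submodule.span_le]
    rintro _ ⟨i, rfl⟩
    exact (hL _).trans (hq i)
  exact hle (hS p)

theorem QuadraticForm.eq_zero_of_single {ι : Type*} [Fintype ι] [DecidableEq ι]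
    (q : QuadraticForm ℝ (ι → ℝ)) (h₁ : ∀ i, q (Pi.single i 1) = 0)
    (h₂ : ∀ i j, i ≠ j → q (Pi.single i 1 + Pi.single j 1) = 0) (x : ι → ℝ) : q x = 0 := by
  have hp : QuadraticMap.polarBilin q = 0 := by
    refine LinearMap.ext_basis (Pi.basisFun ℝ ι) (Pi.basisFun ℝ ι) fun i j => ?_
    by_cases hij : i = j
    · subst hij
      simp [h₁]
    · simp [QuadraticMap.polar, h₁, h₂ i j hij]
  have h := QuadraticMap.polar_self q x
  rw [← QuadraticMap.polarBilin_apply_apply, hp] at h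
  simpa using h.symm

/-- A quadratic form vanishing on the integral points of an affine hyperplane `f = 1` containing
an integral point vanishes identically. -/
theorem QuadraticForm.eq_zero_of_affine {ι : Type*} [Fintype ι] [DecidableEq ι]
    (q : QuadraticForm ℝ (ι → ℝ)) (f : (ι → ℤ) →ₗ[ℤ] ℤ) (y₀ : ι → ℤ) (hy₀ : f y₀ = 1)
    (h : ∀ y : ι → ℤ, f y = 1 → q (fun k => (y k : ℝ)) = 0) (x : ι → ℝ) : q x = 0 := by
  have key : ∀ w : ι → ℤ, q (fun k => (w k : ℝ)) = 0 := by
    intro w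
    set b : ι → ℝ := fun k => (y₀ k : ℝ) with hb
    set z : ι → ℝ := fun k => ((w - f w • y₀) k : ℝ) with hz
    have hline : ∀ n : ℤ, q b + (n : ℝ) ^ 2 * q z + n * QuadraticMap.polar q b z = 0 := by
      intro n
      have := h (y₀ + n • (w - f w • y₀)) (by
        simp only [map_add, map_sub, map_smul, hy₀, smul_eq_mul]
        ring)
      have e : (fun k => ((y₀ + n • (w - f w • y₀)) k : ℝ)) = b + (n : ℝ) • z := by
        ext k; simp [hb, hz]
      rw [e, QuadraticMap.map_add q, QuadraticMap.map_smul, QuadraticMap.polar_smul_right] at this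
      simp only [smul_eq_mul] at this
      linarith
    have h0 := hline 0
    have h1 := hline 1
    have h2 := hline (-1)
    push_cast at h0 h1 h2
    have e : (fun k => (w k : ℝ)) = (f w : ℝ) • b + z := by
      ext k; simp [hb, hz]
    rw [e, QuadraticMap.map_add q, QuadraticMap.map_smul, QuadraticMap.polar_smul_left]
    simp only [smul_eq_mul]
    rw [show q b = 0 by linarith, show q z = 0 by linarith,
      show QuadraticMap.polar q b z = 0 by linarith]
    simp
  refine q.eq_zero_of_single (fun i => ?_) (fun i j _ => ?_) x
  · convert key (Pi.single i 1) using 2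
    ext k; simp [Pi.single_apply]
  · convert key (Pi.single i 1 + Pi.single j 1) using 2
    ext k; simp [Pi.single_apply]

/-- `omegaInt` as a linear map in its second argument. -/
def omegaIntRight (g : ℕ) (x : Fin (2 * g) → ℤ) : (Fin (2 * g) → ℤ) →ₗ[ℤ] ℤ where
  toFun := omegaInt g x
  map_add' y z := by
    simp only [omegaInt, Pi.add_apply, ← Finset.sum_add_distrib]
    exact Finset.sum_congr rfl fun i _ => by ring
  map_smul' c y := by
    simp only [omegaInt, Pi.smul_apply, smul_eq_mul, Finset.mul_sum, RingHom.id_apply]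
    exact Finset.sum_congr rfl fun i _ => by ring

theorem exists_forall_omegaInt_eq (g : ℕ) (i : Fin (2 * g)) :
    ∃ y : Fin (2 * g) → ℤ, ∀ x, omegaInt g x y = x i := by
  by_cases hi : i.1 < g
  · refine ⟨Pi.single ⟨g + i.1, by omega⟩ 1, fun x => ?_⟩
    rw [omegaInt, Finset.sum_eq_single ⟨i.1, hi⟩]
    · simp [Pi.single_apply, Fin.ext_iff]
      omega
    · intro b _ hb
      have : b.1 ≠ i.1 := fun h => hb (Fin.ext h)
      simp [Pi.single_apply, Fin.ext_iff, this]
      omega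
    · simp
  · refine ⟨Pi.single ⟨i.1 - g, by omega⟩ (-1), fun x => ?_⟩
    have hi' : g + (i.1 - g) = i.1 := by omega
    rw [omegaInt, Finset.sum_eq_single ⟨i.1 - g, by omega⟩]
    · simp [Pi.single_apply, Fin.ext_iff, hi']
      omega
    · intro b _ hb
      have : b.1 ≠ i.1 - g := fun h => hb (Fin.ext h)
      simp [Pi.single_apply, Fin.ext_iff, this]
      omega
    · simp

/-- The linear map `y ↦ x yᵀ + y xᵀ`. -/
def symProd {n : Type*} (x : n → ℝ) : (n → ℝ) →ₗ[ℝ] Matrix n n ℝ where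
  toFun y := vecMulVec x y + vecMulVec y x
  map_add' y z := by
    rw [vecMulVec_add, add_vecMulVec]; abel
  map_smul' c y := by
    simp [vecMulVec_smul, smul_vecMulVec]

theorem symProd_comm {n : Type*} (x y : n → ℝ) : symProd x y = symProd y x :=
  add_comm _ _

/-- The symmetric matrix with prescribed entries on unordered pairs of indices. -/
def symMatrix (n : Type*) : (Sym2 n → ℝ) →ₗ[ℝ] Matrix n n ℝ where
  toFun a := Matrix.of fun i j => a s(i, j)
  map_add' _ _ := rfl
  map_smul' _ _ := rfl

theorem exists_symMatrix_eq {n : Type*} (x y : n → ℝ) : ∃ a, symMatrix n a = symProd x y := by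
  refine ⟨Sym2.lift ⟨fun i j => x i * y j + y i * x j, fun i j => by ring⟩, ?_⟩
  ext i j
  change x i * y j + y i * x j = vecMulVec x y i j + vecMulVec y x i j
  simp only [vecMulVec_apply]

theorem eq_zero_of_omegaInt_eq_one {g : ℕ}
    (Q : QuadraticForm ℝ (Matrix (Fin (2 * g)) (Fin (2 * g)) ℝ))
    (h : ∀ x y : Fin (2 * g) → ℤ, omegaInt g x y = 1 →
      Q (symProd (fun k => (x k : ℝ)) (fun k => (y k : ℝ))) = 0)
    (x y : Fin (2 * g) → ℝ) : Q (symProd x y) = 0 := by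
  have key : ∀ (a : Fin (2 * g) → ℤ) (i : Fin (2 * g)), a i = 1 →
      Q (symProd y fun k => (a k : ℝ)) = 0 := by
    intro a i hai
    obtain ⟨b, hb⟩ := exists_forall_omegaInt_eq g i
    rw [symProd_comm]
    exact QuadraticForm.eq_zero_of_affine (Q.comp (symProd fun k => (a k : ℝ))) (omegaIntRight g a) b
      ((hb a).trans hai) (fun z hz => h a z hz) y
  rw [symProd_comm]
  refine QuadraticForm.eq_zero_of_single (Q.comp (symProd y)) (fun i => ?_) (fun i j hij => ?_) x
  · rw [QuadraticMap.comp_apply]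
    convert key (Pi.single i 1) i (by simp) using 3
    ext k; simp [Pi.single_apply]
  · rw [QuadraticMap.comp_apply]
    convert key (Pi.single i 1 + Pi.single j 1) i (by simp [hij]) using 3
    ext k; simp [Pi.single_apply]

theorem card_sym2_sym2_fin (g : ℕ) : Fintype.card (Sym2 (Sym2 (Fin (2 * g)))) =
    g * (2 * g + 1) * (2 * g ^ 2 + g + 1) / 2 := by
  have h : (2 * g + 1) * (2 * g) / 2 = g * (2 * g + 1) := by
    rw [show (2 * g + 1) * (2 * g) = g * (2 * g + 1) * 2 by ring, Nat.mul_div_cancel _ two_pos]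
  rw [Sym2.card, Sym2.card, Fintype.card_fin, Nat.choose_two_right, Nat.choose_two_right]
  simp only [Nat.add_sub_cancel, h]
  congr 1
  ring

/-- Lemma 4.3: there exist `N = g(2g+1)(2g²+g+1)/2` integral symplectic pairs `(xᵢ, yᵢ)`
such that any quadratic form on matrices vanishing on the symmetric products
`xᵢ yᵢᵀ + yᵢ xᵢᵀ` vanishes on all `x yᵀ + y xᵀ`, `x, y ∈ ℝ^{2g}`. -/
theorem stmt1 (g : ℕ) (hg : 1 ≤ g) :
    ∃ S : Fin (g * (2 * g + 1) * (2 * g ^ 2 + g + 1) / 2) →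
        (Fin (2 * g) → ℤ) × (Fin (2 * g) → ℤ),
      (∀ i, omegaInt g (S i).1 (S i).2 = 1) ∧
      ∀ Q : QuadraticForm ℝ (Matrix (Fin (2 * g)) (Fin (2 * g)) ℝ),
        (∀ i, Q (vecMulVec (fun k => ((S i).1 k : ℝ)) (fun k => ((S i).2 k : ℝ)) +
                vecMulVec (fun k => ((S i).2 k : ℝ)) (fun k => ((S i).1 k : ℝ))) = 0) →
        ∀ x y : Fin (2 * g) → ℝ, Q (vecMulVec x y + vecMulVec y x) = 0 := by
  have : Nonempty {p : (Fin (2 * g) → ℤ) × (Fin (2 * g) → ℤ) // omegaInt g p.1 p.2 = 1} := by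
    obtain ⟨y, hy⟩ := exists_forall_omegaInt_eq g ⟨0, by omega⟩
    exact ⟨⟨(Pi.single ⟨0, by omega⟩ 1, y), by simp [hy]⟩⟩
  choose v hv using fun p : {p : (Fin (2 * g) → ℤ) × (Fin (2 * g) → ℤ) //
    omegaInt g p.1 p.2 = 1} =>
      exists_symMatrix_eq (fun k => (p.1.1 k : ℝ)) (fun k => (p.1.2 k : ℝ))
  obtain ⟨S, hS⟩ := QuadraticForm.exists_fin_eq_zero v (card_sym2_sym2_fin g).le
  refine ⟨fun i => (S i).1, fun i => (S i).2, fun Q hQ => ?_⟩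
  refine eq_zero_of_omegaInt_eq_one Q fun x y hxy => ?_
  have := hS (Q.comp (symMatrix _)) (fun i => ?_) ⟨(x, y), hxy⟩
  · rwa [QuadraticMap.comp_apply, hv] at this
  · rw [QuadraticMap.comp_apply, hv]
    exact hQ i
end

section
/- Let g ≥ 1 and let Q be a quadratic form on the space of real 2g×2g matrices. If Q(x yᵀ + y xᵀ) = 0 for every pair of integer vectors x, y ∈ ℤ^{2g} with ω(x,y) = 1, then Q(x yᵀ + y xᵀ) = 0 for all real vectors x, y ∈ ℝ^{2g}. -/
open Matrix

/-- A real quadratic form on `ℝⁿ` vanishing at all integral vectors is zero. -/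
theorem QuadraticForm.eq_zero_of_forall_intCast {ι : Type*} [Finite ι]
    (q : QuadraticForm ℝ (ι → ℝ)) (h : ∀ y : ι → ℤ, q (fun k => (y k : ℝ)) = 0) : q = 0 := by
  classical
  have hp : q.polarBilin = 0 := by
    refine LinearMap.ext_basis (Pi.basisFun ℝ ι) (Pi.basisFun ℝ ι) fun i j => ?_
    have hc (l : ι) : (Pi.single l 1 : ι → ℝ) = fun k => ((Pi.single l 1 : ι → ℤ) k : ℝ) := by
      ext k
      by_cases hk : k = l <;> simp [hk]
    have hadd := h (Pi.single i 1 + Pi.single j 1)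
    simp only [Pi.add_apply, Int.cast_add] at hadd
    simp only [Pi.basisFun_apply, QuadraticMap.polarBilin_apply_apply, LinearMap.zero_apply,
      QuadraticMap.polar, hc, h]
    simpa [Pi.add_def] using hadd
  ext x
  have hx : q.polarBilin x x = 0 := by simp [hp]
  simpa [QuadraticMap.polar_self] using hx

/-- A real quadratic form on `ℝⁿ` vanishing at the integral points of an affine hyperplane
`a = 1`, where `a` is an integral functional attaining the value `1`, is zero. -/
theorem QuadraticForm.eq_zero_of_forall_intCast_eq_one {ι : Type*} [Finite ι]
    (q : QuadraticForm ℝ (ι → ℝ)) (a : (ι → ℤ) →+ ℤ) (y₀ : ι → ℤ) (hy₀ : a y₀ = 1)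
    (h : ∀ y : ι → ℤ, a y = 1 → q (fun k => (y k : ℝ)) = 0) : q = 0 := by
  refine q.eq_zero_of_forall_intCast fun y => ?_
  set u : ι → ℝ := fun k => (y₀ k : ℝ) with hu
  set v : ι → ℝ := fun k => ((y - a y • y₀) k : ℝ) with hv
  have expand (s t : ℝ) :
      q (s • u + t • v) = s * s * q u + t * t * q v + s * t * QuadraticMap.polar q u v := by
    rw [QuadraticMap.map_add q, QuadraticMap.map_smul, QuadraticMap.map_smul,
      QuadraticMap.polar_smul_left, QuadraticMap.polar_smul_right]
    simp only [smul_eq_mul]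
    ring
  have hline (n : ℤ) : q ((1 : ℝ) • u + (n : ℝ) • v) = 0 := by
    rw [← h (y₀ + n • (y - a y • y₀)) (by simp only [map_add, map_sub, map_zsmul, hy₀, smul_eq_mul]; ring)]
    congr 1
    ext k
    simp [hu, hv]
  have h0 := hline 0
  have h1 := hline 1
  have h2 := hline (-1)
  rw [expand] at h0 h1 h2
  push_cast at h0 h1 h2
  have hqu : q u = 0 := by linarith
  have hqv : q v = 0 := by linarith
  have hpol : QuadraticMap.polar q u v = 0 := by linarith
  have hy : (fun k => (y k : ℝ)) = (a y : ℝ) • u + (1 : ℝ) • v := by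
    ext k
    simp [hu, hv]
  rw [hy, expand, hqu, hqv, hpol]
  ring

/-- The linear map `y ↦ x yᵀ + y xᵀ`. -/
def symVecMulVec {ι : Type*} (x : ι → ℝ) : (ι → ℝ) →ₗ[ℝ] Matrix ι ι ℝ where
  toFun y := vecMulVec x y + vecMulVec y x
  map_add' y z := by
    rw [vecMulVec_add, add_vecMulVec]
    abel
  map_smul' c y := by
    simp [vecMulVec_smul, smul_vecMulVec]

/-- The functional `ω(x, ·)`. -/
def omegaIntHom (g : ℕ) (x : Fin (2 * g) → ℤ) : (Fin (2 * g) → ℤ) →+ ℤ :=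
  AddMonoidHom.mk' (omegaInt g x) fun y z => by
    simp only [omegaInt, Pi.add_apply, ← Finset.sum_add_distrib]
    exact Finset.sum_congr rfl fun i _ => by ring

theorem omegaInt_single (g : ℕ) (hg : 1 ≤ g) (x : Fin (2 * g) → ℤ) :
    omegaInt g x (Pi.single ⟨g, by omega⟩ 1) = x ⟨0, by omega⟩ := by
  rw [omegaInt, Finset.sum_eq_single ⟨0, hg⟩]
  · have : g ≠ 0 := by omega
    simp [this.symm]
  · intro i _ hi
    have hi' : i.1 ≠ 0 := fun h => hi (Fin.ext h)
    have := i.2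
    simp [hi', this.ne]
  · simp

/-- Key claim in the proof of Lemma 4.3: a quadratic form on matrices vanishing on
`x yᵀ + y xᵀ` for all integral pairs with `ω(x,y) = 1` vanishes on `x yᵀ + y xᵀ`
for all real `x, y`. -/
theorem stmt2 (g : ℕ) (hg : 1 ≤ g)
    (Q : QuadraticForm ℝ (Matrix (Fin (2 * g)) (Fin (2 * g)) ℝ))
    (hQ : ∀ x y : Fin (2 * g) → ℤ, omegaInt g x y = 1 →
      Q (vecMulVec (fun k => (x k : ℝ)) (fun k => (y k : ℝ)) +
        vecMulVec (fun k => (y k : ℝ)) (fun k => (x k : ℝ))) = 0) :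
    ∀ x y : Fin (2 * g) → ℝ, Q (vecMulVec x y + vecMulVec y x) = 0 := by
  have key (x : Fin (2 * g) → ℤ) (hx : x ⟨0, by omega⟩ = 1) :
      Q.comp (symVecMulVec fun k => (x k : ℝ)) = 0 :=
    QuadraticForm.eq_zero_of_forall_intCast_eq_one _ (omegaIntHom g x)
      (Pi.single ⟨g, by omega⟩ 1) ((omegaInt_single g hg x).trans hx) fun y hy => hQ x y hy
  intro x y
  have hy : Q.comp (symVecMulVec y) = 0 := by
    refine QuadraticForm.eq_zero_of_forall_intCast_eq_one _
      (Pi.evalAddMonoidHom (fun _ => ℤ) ⟨0, by omega⟩) (Pi.single ⟨0, by omega⟩ 1)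
      (by simp) fun x hx => ?_
    have hxy := DFunLike.congr_fun (key x hx) y
    simpa [symVecMulVec, add_comm] using hxy
  have hxy := DFunLike.congr_fun hy x
  simpa [symVecMulVec, add_comm] using hxy
end

section
/- Let g ≥ 1 and let P be a real polynomial in the (2g)² entries of a 2g×2g matrix. If P(A) = 0 for every integer matrix A ∈ Sp(2g,ℤ) (i.e. every A with integer entries satisfying AᵀJA = J), then P(A) = 0 for every real matrix A ∈ Sp(2g,ℝ). -/
open Matrix

/-- The matrix `J` of the standard symplectic form on `R^{2g}`, so that `ω(x,y) = xᵀ J y`. -/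
def Jmat (g : ℕ) (R : Type*) [Ring R] : Matrix (Fin (2 * g)) (Fin (2 * g)) R :=
  Matrix.of fun i j =>
    if (i : ℕ) + g = (j : ℕ) then 1 else if (j : ℕ) + g = (i : ℕ) then -1 else 0

section SymplecticTransvection

variable {n R S : Type*} [Fintype n] [CommRing R] [CommRing S]

theorem dotProduct_mulVec_swap {M : Matrix n n R} (hM : Mᵀ = -M) (x y : n → R) :
    x ⬝ᵥ M *ᵥ y = -(y ⬝ᵥ M *ᵥ x) := by
  rw [← dotProduct_transpose_mulVec, hM, neg_mulVec, dotProduct_neg]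

theorem dotProduct_mulVec_self_of_skew [IsDomain R] [CharZero R] {M : Matrix n n R}
    (hM : Mᵀ = -M) (x : n → R) : x ⬝ᵥ M *ᵥ x = 0 :=
  self_eq_neg.1 (dotProduct_mulVec_swap hM x x)

theorem dotProduct_mulVec_mulVec_of_isometry {M A : Matrix n n R} (hA : Aᵀ * M * A = M)
    (x y : n → R) : (A *ᵥ x) ⬝ᵥ M *ᵥ (A *ᵥ y) = x ⬝ᵥ M *ᵥ y := by
  conv_rhs => rw [← hA]
  rw [← mulVec_mulVec, ← mulVec_mulVec, dotProduct_mulVec x Aᵀ, vecMul_transpose]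

theorem isometry_mul {M A B : Matrix n n R} (hA : Aᵀ * M * A = M) (hB : Bᵀ * M * B = M) :
    (A * B)ᵀ * M * (A * B) = M := by
  rw [transpose_mul, show Bᵀ * Aᵀ * M * (A * B) = Bᵀ * (Aᵀ * M * A) * B by noncomm_ring, hA, hB]

variable [DecidableEq n]

/-- The matrix of the transvection `x ↦ x + t ω(v, x) v`, where `ω(x, y) = xᵀ M y`. -/
def symplecticTransvection (M : Matrix n n R) (v : n → R) (t : R) : Matrix n n R :=
  1 + t • vecMulVec v (v ᵥ* M)

theorem symplecticTransvection_map (M : Matrix n n R) (v : n → R) (t : R) (f : R →+* S) :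
    (symplecticTransvection M v t).map f = symplecticTransvection (M.map f) (f ∘ v) (f t) := by
  ext i j
  simp [symplecticTransvection, Matrix.one_apply, vecMulVec_apply, vecMul, dotProduct, apply_ite f]

theorem symplecticTransvection_mulVec (M : Matrix n n R) (v x : n → R) (t : R) :
    symplecticTransvection M v t *ᵥ x = x + (t * (v ⬝ᵥ M *ᵥ x)) • v := by
  simp [symplecticTransvection, add_mulVec, smul_mulVec, vecMulVec_mulVec, dotProduct_mulVec,
    smul_smul]

theorem isometry_of_dotProduct_mulVec_mulVec {M A : Matrix n n R}
    (hA : ∀ x y, (A *ᵥ x) ⬝ᵥ M *ᵥ (A *ᵥ y) = x ⬝ᵥ M *ᵥ y) : Aᵀ * M * A = M := by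
  refine Matrix.ext_of_mulVec_single fun j => ?_
  refine dotProduct_eq _ _ fun x => ?_
  rw [dotProduct_comm, dotProduct_comm _ x, ← hA, ← mulVec_mulVec, ← mulVec_mulVec,
    dotProduct_mulVec x Aᵀ, vecMul_transpose]

section Skew

variable [IsDomain R] [CharZero R] {M : Matrix n n R}

theorem symplecticTransvection_isometry (hM : Mᵀ = -M) (v : n → R) (t : R) :
    (symplecticTransvection M v t)ᵀ * M * symplecticTransvection M v t = M := by
  refine isometry_of_dotProduct_mulVec_mulVec fun x y => ?_
  simp only [symplecticTransvection_mulVec, mulVec_add, mulVec_smul, dotProduct_add,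
    add_dotProduct, smul_dotProduct, dotProduct_smul, smul_eq_mul,
    dotProduct_mulVec_self_of_skew hM, dotProduct_mulVec_swap hM x v]
  ring

theorem symplecticTransvection_neg_mul (hM : Mᵀ = -M) (v : n → R) (t : R) :
    symplecticTransvection M v (-t) * symplecticTransvection M v t = 1 := by
  refine Matrix.ext_of_mulVec_single fun j => ?_
  simp only [← mulVec_mulVec, symplecticTransvection_mulVec, mulVec_add, mulVec_smul,
    dotProduct_mulVec_self_of_skew hM, one_mulVec]
  ext i
  simp

end Skew

section Generation

variable {K : Type*} [Field K] [CharZero K] {M A : Matrix n n K}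

/-- A transvection moving `x` to `w` and fixing every vector orthogonal to `w - x`. -/
theorem exists_symplecticTransvection_mulVec_eq (hM : Mᵀ = -M) {x w : n → K}
    (h : w ⬝ᵥ M *ᵥ x ≠ 0) :
    ∃ v t, symplecticTransvection M v t *ᵥ x = w ∧
      ∀ y, (w - x) ⬝ᵥ M *ᵥ y = 0 → symplecticTransvection M v t *ᵥ y = y := by
  refine ⟨w - x, (w ⬝ᵥ M *ᵥ x)⁻¹, ?_, fun y hy => ?_⟩
  · simp [symplecticTransvection_mulVec, sub_dotProduct, dotProduct_mulVec_self_of_skew hM, h]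
  · simp [symplecticTransvection_mulVec, hy]

/-- Multiplying a nontrivial isometry by at most two transvections enlarges its fixed space. -/
theorem exists_symplecticTransvection_mul_fixes_more (hM : Mᵀ = -M)
    (hnd : ∀ u, (∀ z, u ⬝ᵥ M *ᵥ z = 0) → u = 0) (hA : Aᵀ * M * A = M) (hA1 : A ≠ 1) :
    ∃ v s w t, (∀ y, A *ᵥ y = y →
        symplecticTransvection M v s *ᵥ symplecticTransvection M w t *ᵥ A *ᵥ y = y) ∧
      ∃ x, A *ᵥ x ≠ x ∧
        symplecticTransvection M v s *ᵥ symplecticTransvection M w t *ᵥ A *ᵥ x = x := by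
  have hfix : ∀ y, A *ᵥ y = y → ∀ x, (A *ᵥ x) ⬝ᵥ M *ᵥ y = x ⬝ᵥ M *ᵥ y := fun y hy x => by
    rw [← dotProduct_mulVec_mulVec_of_isometry hA x y, hy]
  by_cases hx : ∃ x, x ⬝ᵥ M *ᵥ (A *ᵥ x) ≠ 0
  · obtain ⟨x, hx⟩ := hx
    have hone : symplecticTransvection M 0 0 = 1 := by simp [symplecticTransvection]
    obtain ⟨v, s, hv, hv'⟩ := exists_symplecticTransvection_mulVec_eq hM hx
    refine ⟨v, s, 0, 0, fun y hy => ?_, x, fun h => hx ?_, ?_⟩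
    · rw [hy, hone, one_mulVec, hv' y (by rw [sub_dotProduct, hfix y hy, sub_self])]
    · rw [h, dotProduct_mulVec_self_of_skew hM]
    · rw [hone, one_mulVec, hv]
  push Not at hx
  obtain ⟨x, hx1⟩ : ∃ x, A *ᵥ x ≠ x := by
    by_contra! h
    exact hA1 (Matrix.ext_of_mulVec_single fun j => by rw [h, one_mulVec])
  obtain ⟨z, hz⟩ : ∃ z, (A *ᵥ x - x) ⬝ᵥ M *ᵥ z ≠ 0 := by
    by_contra! h
    exact hx1 (sub_eq_zero.1 (hnd _ h))
  have hpol : x ⬝ᵥ M *ᵥ (A *ᵥ z) + z ⬝ᵥ M *ᵥ (A *ᵥ x) = 0 := by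
    have := hx (x + z)
    rw [mulVec_add, mulVec_add, add_dotProduct, dotProduct_add, dotProduct_add, hx, hx] at this
    linear_combination this
  have hiso := dotProduct_mulVec_mulVec_of_isometry hA z x
  have hxx := dotProduct_mulVec_self_of_skew hM x
  rw [sub_dotProduct] at hz
  -- The intermediate vector `w` keeps `A x - w` and `w - x` in the image of `A - 1`.
  set w := x + (A *ᵥ z - z) with hw
  have h₁ : w ⬝ᵥ M *ᵥ (A *ᵥ x) ≠ 0 := by
    rw [hw, add_dotProduct, sub_dotProduct, hiso, hx, dotProduct_mulVec_swap hM z x,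
      dotProduct_mulVec_swap hM z (A *ᵥ x)]
    contrapose! hz
    linear_combination hz
  have h₂ : x ⬝ᵥ M *ᵥ w ≠ 0 := by
    rw [hw, mulVec_add, mulVec_sub, dotProduct_add, dotProduct_sub, hxx]
    rw [dotProduct_mulVec_swap hM z (A *ᵥ x)] at hpol
    contrapose! hz
    linear_combination hz - hpol
  obtain ⟨v₁, s₁, hv₁, hv₁'⟩ := exists_symplecticTransvection_mulVec_eq hM h₁
  obtain ⟨v₂, s₂, hv₂, hv₂'⟩ := exists_symplecticTransvection_mulVec_eq hM h₂
  refine ⟨v₂, s₂, v₁, s₁, fun y hy => ?_, x, hx1, by rw [hv₁, hv₂]⟩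
  have hwy : w ⬝ᵥ M *ᵥ y = x ⬝ᵥ M *ᵥ y := by
    rw [hw, add_dotProduct, sub_dotProduct, hfix y hy, sub_self, add_zero]
  rw [hy, hv₁' y, hv₂' y]
  · rw [sub_dotProduct, hwy, sub_self]
  · rw [sub_dotProduct, hwy, hfix y hy, sub_self]

/-- A submonoid containing all transvections contains all isometries of a symplectic form. -/
theorem isometry_mem_of_symplecticTransvection_mem (hM : Mᵀ = -M)
    (hnd : ∀ u, (∀ z, u ⬝ᵥ M *ᵥ z = 0) → u = 0) (H : Submonoid (Matrix n n K))
    (hH : ∀ v t, symplecticTransvection M v t ∈ H) (hA : Aᵀ * M * A = M) : A ∈ H := by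
  induction hk : Module.finrank K (LinearMap.range (A - 1).mulVecLin) using Nat.strong_induction_on
    generalizing A with
  | _ k ih =>
  by_cases hA1 : A = 1
  · exact hA1 ▸ H.one_mem
  obtain ⟨v, s, w, t, hfix, x, hx, hx'⟩ :=
    exists_symplecticTransvection_mul_fixes_more hM hnd hA hA1
  set V := symplecticTransvection M v s
  set W := symplecticTransvection M w t
  have hmem : V * (W * A) ∈ H := by
    refine ih _ ?_ (isometry_mul (symplecticTransvection_isometry hM v s)
      (isometry_mul (symplecticTransvection_isometry hM w t) hA)) rfl
    have hlt : LinearMap.ker (A - 1).mulVecLin < LinearMap.ker (V * (W * A) - 1).mulVecLin := by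
      refine SetLike.lt_iff_le_and_exists.2 ⟨fun y hy => ?_, x, ?_, ?_⟩ <;>
        simp_all [sub_eq_zero]
    have h₁ := LinearMap.finrank_range_add_finrank_ker (A - 1).mulVecLin
    have h₂ := LinearMap.finrank_range_add_finrank_ker (V * (W * A) - 1).mulVecLin
    have h₃ := Submodule.finrank_lt_finrank_of_lt hlt
    omega
  have hprod : A = symplecticTransvection M w (-t) *
      (symplecticTransvection M v (-s) * (V * (W * A))) := by
    rw [← mul_assoc _ V, symplecticTransvection_neg_mul hM, one_mul, ← mul_assoc,
      symplecticTransvection_neg_mul hM, one_mul]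
  rw [hprod]
  exact H.mul_mem (hH _ _) (H.mul_mem (hH _ _) hmem)

end Generation

end SymplecticTransvection

section ZariskiClosure

variable {n R : Type*} [CommRing R]

/-- Substituting a matrix of polynomials into a polynomial in the matrix entries commutes with
evaluation. -/
theorem eval_aeval_matrix {σ : Type*} (F : Matrix n n (MvPolynomial σ R))
    (P : MvPolynomial (n × n) R) (x : σ → R) :
    MvPolynomial.eval x (MvPolynomial.aeval (fun p => F p.1 p.2) P) =
      MvPolynomial.eval (fun p => F.map (MvPolynomial.eval x) p.1 p.2) P := by
  simpa [MvPolynomial.aeval_eq_bind₁, MvPolynomial.coe_aeval_eq_eval] using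
    MvPolynomial.aeval_bind₁ x (fun p : n × n => F p.1 p.2) P

variable [Fintype n] [DecidableEq n]

/-- The Zariski closure of a submonoid of matrices. -/
def matrixZariskiClosure (G : Submonoid (Matrix n n R)) : Submonoid (Matrix n n R) where
  carrier := {A | ∀ P : MvPolynomial (n × n) R,
    (∀ B ∈ G, MvPolynomial.eval (fun p => B p.1 p.2) P = 0) →
      MvPolynomial.eval (fun p => A p.1 p.2) P = 0}
  one_mem' := fun _ hP => hP 1 G.one_mem
  mul_mem' := by
    intro A B hA hB P hP
    let X : Matrix n n (MvPolynomial (n × n) R) := Matrix.of fun i j => MvPolynomial.X (i, j)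
    have hX : ∀ D : Matrix n n R, X.map (MvPolynomial.eval fun p => D p.1 p.2) = D := fun D => by
      ext; simp [X]
    let c : Matrix n n R → Matrix n n (MvPolynomial (n × n) R) := fun D => D.map MvPolynomial.C
    have hC : ∀ D E : Matrix n n R, (c D).map (MvPolynomial.eval fun p => E p.1 p.2) = D :=
      fun D E => by ext; simp [c]
    have hleft : ∀ D E : Matrix n n R, MvPolynomial.eval (fun p : n × n => E p.1 p.2)
        (MvPolynomial.aeval (fun p => (c D * X) p.1 p.2) P) =
          MvPolynomial.eval (fun p => (D * E) p.1 p.2) P := fun D E => by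
      rw [eval_aeval_matrix, Matrix.map_mul, hX, hC]
    have hright : ∀ D E : Matrix n n R, MvPolynomial.eval (fun p : n × n => D p.1 p.2)
        (MvPolynomial.aeval (fun p => (X * c E) p.1 p.2) P) =
          MvPolynomial.eval (fun p => (D * E) p.1 p.2) P := fun D E => by
      rw [eval_aeval_matrix, Matrix.map_mul, hX, hC]
    rw [← hleft]
    refine hB _ fun E hE => ?_
    rw [hleft, ← hright]
    refine hA _ fun D hD => ?_
    rw [hright]
    exact hP _ (G.mul_mem hD hE)

theorem symplecticTransvection_mem_matrixZariskiClosure [IsDomain R] [CharZero R]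
    {M : Matrix n n R} {G : Submonoid (Matrix n n R)}
    (hG : ∀ (v : n → ℤ) (t : ℤ), symplecticTransvection M (fun i => (v i : R)) t ∈ G)
    (v : n → R) (t : R) : symplecticTransvection M v t ∈ matrixZariskiClosure G := by
  intro P hP
  let F : Matrix n n (MvPolynomial (Option n) R) :=
    symplecticTransvection (M.map MvPolynomial.C) (fun i => MvPolynomial.X (some i))
      (MvPolynomial.X none)
  have hF : ∀ x : Option n → R, F.map (MvPolynomial.eval x) =
      symplecticTransvection M (fun i => x (some i)) (x none) := fun x => by
    rw [symplecticTransvection_map]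
    congr 1
    · ext; simp
    · ext; simp
    · simp
  have hzero : MvPolynomial.aeval (fun p => F p.1 p.2) P = 0 := by
    refine MvPolynomial.funext_set (fun _ => Set.range ((↑) : ℤ → R))
      (fun _ => Set.infinite_range_of_injective Int.cast_injective) fun x hx => ?_
    choose y hy using fun i => hx i (Set.mem_univ i)
    obtain rfl : (fun i => (y i : R)) = x := _root_.funext hy
    rw [eval_aeval_matrix, hF, map_zero]
    exact hP _ (hG _ _)
  have := eval_aeval_matrix F P fun o => o.elim t v
  rw [hzero, hF, map_zero] at this
  exact this.symm

end ZariskiClosure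

theorem Jmat_transpose (g : ℕ) (R : Type*) [Ring R] : (Jmat g R)ᵀ = -Jmat g R := by
  ext i j
  have := i.2
  rw [transpose_apply, Matrix.neg_apply]
  simp only [Jmat, of_apply]
  split_ifs <;> first | omega | simp

theorem Jmat_map (g : ℕ) {R S : Type*} [Ring R] [Ring S] (f : R →+* S) :
    (Jmat g R).map f = Jmat g S := by
  ext i j
  simp [Jmat, apply_ite f]

theorem Jmat_nondegenerate (g : ℕ) {R : Type*} [Ring R] (u : Fin (2 * g) → R)
    (hu : ∀ z, u ⬝ᵥ Jmat g R *ᵥ z = 0) : u = 0 := by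
  have hcol : ∀ j, ∑ k, u k * Jmat g R k j = 0 := fun j => by
    simpa [dotProduct] using hu (Pi.single j 1)
  ext i
  by_cases hi : (i : ℕ) < g
  · have := hcol ⟨i + g, by omega⟩
    rw [Finset.sum_eq_single i _ (by simp)] at this
    · simpa [Jmat] using this
    · intro k _ hk
      have hk' := Fin.val_ne_of_ne hk
      have := k.2
      simp only [Jmat, of_apply]
      rw [if_neg (by omega), if_neg (by omega), mul_zero]
  · have := hcol ⟨i - g, by omega⟩
    rw [Finset.sum_eq_single i _ (by simp)] at this
    · simp only [Jmat, of_apply] at this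
      rw [if_neg (by omega), if_pos (by omega)] at this
      simpa using this
    · intro k _ hk
      have hk' := Fin.val_ne_of_ne hk
      have := k.2
      simp only [Jmat, of_apply]
      rw [if_neg (by omega), if_neg (by omega), mul_zero]

/-- The integral symplectic matrices, viewed as a submonoid of the real matrices. -/
def integralSymplectic (g : ℕ) : Submonoid (Matrix (Fin (2 * g)) (Fin (2 * g)) ℝ) where
  carrier := {B | ∃ A : Matrix (Fin (2 * g)) (Fin (2 * g)) ℤ,
    Aᵀ * Jmat g ℤ * A = Jmat g ℤ ∧ A.map (Int.castRingHom ℝ) = B}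
  one_mem' := ⟨1, by simp, by simp⟩
  mul_mem' := by
    rintro _ _ ⟨A, hA, rfl⟩ ⟨B, hB, rfl⟩
    exact ⟨A * B, isometry_mul hA hB, Matrix.map_mul⟩

/-- Zariski density of `Sp(2g,ℤ)` in `Sp(2g,ℝ)`: a real polynomial in the matrix entries
vanishing on every integral symplectic matrix vanishes on every real symplectic matrix. -/
theorem stmt5 (g : ℕ) (hg : 1 ≤ g)
    (P : MvPolynomial (Fin (2 * g) × Fin (2 * g)) ℝ)
    (hP : ∀ A : Matrix (Fin (2 * g)) (Fin (2 * g)) ℤ,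
      Aᵀ * Jmat g ℤ * A = Jmat g ℤ →
      MvPolynomial.eval (fun p => (A p.1 p.2 : ℝ)) P = 0) :
    ∀ A : Matrix (Fin (2 * g)) (Fin (2 * g)) ℝ,
      Aᵀ * Jmat g ℝ * A = Jmat g ℝ →
      MvPolynomial.eval (fun p => A p.1 p.2) P = 0 := by
  intro A hA
  refine isometry_mem_of_symplecticTransvection_mem (Jmat_transpose g ℝ) (Jmat_nondegenerate g)
    (matrixZariskiClosure (integralSymplectic g))
    (symplecticTransvection_mem_matrixZariskiClosure fun v t => ?_) hA P ?_
  · refine ⟨symplecticTransvection (Jmat g ℤ) v t,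
      symplecticTransvection_isometry (Jmat_transpose g ℤ) v t, ?_⟩
    rw [symplecticTransvection_map, Jmat_map]
    rfl
  · rintro _ ⟨B, hB, rfl⟩
    exact hP B hB
end

section
/- Let g ≥ 2 and set N = g(2g+1)(2g²+g+1)/2. There exists a set S of N pairs (x,y) of integer vectors x, y ∈ ℤ^{2g} with ω(x,y) = 1 such that: for all linear maps u, v : ℝ^{2g} → ℝ³ with u surjective, [u∧u] = 0, [u∧v] = 0, and Q_{u,v}(x,y) = 0 for every (x,y) ∈ S, there exists ξ ∈ ℝ³ such that v(x) = ξ × u(x) for all x ∈ ℝ^{2g}. -/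
open Matrix

section SymplecticForm

variable {R : Type*} [CommRing R]

/-- The standard symplectic form on `R^{2g}`, over an arbitrary commutative ring. -/
def symplecticSum (g : ℕ) (x y : Fin (2 * g) → R) : R :=
  ∑ i : Fin g,
    (x ⟨i.1, by have := i.2; omega⟩ * y ⟨g + i.1, by have := i.2; omega⟩ -
      x ⟨g + i.1, by have := i.2; omega⟩ * y ⟨i.1, by have := i.2; omega⟩)

theorem map_symplecticSum {A : Type*} [CommRing A] (φ : R →+* A) (g : ℕ)
    (x y : Fin (2 * g) → R) :
    φ (symplecticSum g x y) = symplecticSum g (φ ∘ x) (φ ∘ y) := by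
  simp [symplecticSum]

theorem symplecticSum_smul_smul (g : ℕ) (a b : R) (x y : Fin (2 * g) → R) :
    symplecticSum g (a • x) (b • y) = a * b * symplecticSum g x y := by
  simp only [symplecticSum, Finset.mul_sum, Pi.smul_apply, smul_eq_mul]
  exact Finset.sum_congr rfl fun i _ => by ring

theorem symplecticSum_add_single {g : ℕ} (i : Fin g) (x y : Fin (2 * g) → R) (t : R) :
    symplecticSum g x (y + Pi.single ⟨g + i.1, by have := i.2; omega⟩ t) =
      symplecticSum g x y + x ⟨i.1, by have := i.2; omega⟩ * t := by
  have h1 (k : Fin g) : (⟨k.1, by have := k.2; omega⟩ : Fin (2 * g)) ≠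
      ⟨g + i.1, by have := i.2; omega⟩ := by
    have := k.2
    simp only [ne_eq, Fin.mk.injEq]
    omega
  simp only [symplecticSum, Pi.add_apply, Pi.single_apply, h1, if_false, add_zero, Fin.mk.injEq,
    add_right_inj, ← Fin.ext_iff]
  rw [← sub_eq_iff_eq_add', ← Finset.sum_sub_distrib, Finset.sum_eq_single i]
  · simp only [if_true]
    ring
  · intro k _ hk
    simp [hk]
  · simp

/-- Replace the coordinate of `x` at `e_i` by `1`. -/
def normalizeFst {g : ℕ} (i : Fin g) (x : Fin (2 * g) → R) : Fin (2 * g) → R :=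
  Function.update x ⟨i.1, by have := i.2; omega⟩ 1

/-- Correct the coordinate of `y` at `f_i` so that `y` pairs to `1` with `normalizeFst i x`. -/
def normalizeSnd {g : ℕ} (i : Fin g) (x y : Fin (2 * g) → R) : Fin (2 * g) → R :=
  y + Pi.single ⟨g + i.1, by have := i.2; omega⟩ (1 - symplecticSum g (normalizeFst i x) y)

theorem symplecticSum_normalize {g : ℕ} (i : Fin g) (x y : Fin (2 * g) → R) :
    symplecticSum g (normalizeFst i x) (normalizeSnd i x y) = 1 := by
  rw [normalizeSnd, symplecticSum_add_single]
  simp [normalizeFst]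

theorem normalizeFst_eq_self {g : ℕ} {i : Fin g} {x : Fin (2 * g) → R}
    (hx : x ⟨i.1, by have := i.2; omega⟩ = 1) : normalizeFst i x = x := by
  rw [normalizeFst, ← hx, Function.update_eq_self]

theorem normalizeSnd_eq_self {g : ℕ} {i : Fin g} {x y : Fin (2 * g) → R}
    (hx : x ⟨i.1, by have := i.2; omega⟩ = 1) (hxy : symplecticSum g x y = 1) :
    normalizeSnd i x y = y := by
  simp [normalizeSnd, normalizeFst_eq_self hx, hxy]

theorem map_comp_normalizeFst {A : Type*} [CommRing A] (φ : R →+* A) {g : ℕ} (i : Fin g)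
    (x : Fin (2 * g) → R) : φ ∘ normalizeFst i x = normalizeFst i (φ ∘ x) := by
  simp [normalizeFst, Function.comp_update]

theorem map_comp_normalizeSnd {A : Type*} [CommRing A] (φ : R →+* A) {g : ℕ} (i : Fin g)
    (x y : Fin (2 * g) → R) :
    φ ∘ normalizeSnd i x y = normalizeSnd i (φ ∘ x) (φ ∘ y) := by
  rw [normalizeSnd, normalizeSnd, ← map_comp_normalizeFst, ← map_symplecticSum]
  ext k
  simp only [Function.comp_apply, Pi.add_apply, map_add, Pi.single_apply]
  split_ifs <;> simp

end SymplecticForm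

section BiquadraticForm

variable {ι R : Type*} [Fintype ι] [CommRing R]

/-- The form `∑ c_{ijkl} x_i x_j y_k y_l`, quadratic in each of `x` and `y`. -/
def biquadratic (c : ι → ι → ι → ι → R) (x y : ι → R) : R :=
  ∑ i, ∑ j, ∑ k, ∑ l, c i j k l * (x i * x j * y k * y l)

theorem map_biquadratic {A : Type*} [CommRing A] (φ : R →+* A) (c : ι → ι → ι → ι → R)
    (x y : ι → R) :
    φ (biquadratic c x y) = biquadratic (fun i j k l => φ (c i j k l)) (φ ∘ x) (φ ∘ y) := by
  simp [biquadratic]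

theorem biquadratic_smul_smul (c : ι → ι → ι → ι → R) (a b : R) (x y : ι → R) :
    biquadratic c (a • x) (b • y) = a ^ 2 * b ^ 2 * biquadratic c x y := by
  simp only [biquadratic, Finset.mul_sum, Pi.smul_apply, smul_eq_mul]
  refine Finset.sum_congr rfl fun i _ => Finset.sum_congr rfl fun j _ =>
    Finset.sum_congr rfl fun k _ => Finset.sum_congr rfl fun l _ => by ring

/-- The monomials `x_i x_j y_k y_l + y_i y_j x_k x_l`, indexed by pairs of pairs of indices. -/
def pairMonomials (x y : ι → R) : Sym2 (Sym2 ι) → R :=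
  Sym2.lift ⟨fun a b => (a.map x).mul * (b.map y).mul + (a.map y).mul * (b.map x).mul,
    fun a b => by ring⟩

theorem biquadratic_add_swap (c : ι → ι → ι → ι → R) (x y : ι → R) :
    biquadratic c x y + biquadratic c y x =
      ∑ i, ∑ j, ∑ k, ∑ l, c i j k l * pairMonomials x y s(s(i, j), s(k, l)) := by
  simp only [biquadratic, ← Finset.sum_add_distrib, pairMonomials, Sym2.lift_mk, Sym2.map_mk,
    Sym2.mul_mk]
  refine Finset.sum_congr rfl fun i _ => Finset.sum_congr rfl fun j _ =>
    Finset.sum_congr rfl fun k _ => Finset.sum_congr rfl fun l _ => by ring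

/-- The integral symplectic pairs are Zariski dense among all real pairs, as far as forms
of degree `(2, 2)` are concerned. -/
theorem biquadratic_eq_zero_of_integral {g : ℕ} (i₀ : Fin g)
    (c : Fin (2 * g) → Fin (2 * g) → Fin (2 * g) → Fin (2 * g) → ℝ)
    (h : ∀ x y : Fin (2 * g) → ℤ, symplecticSum g x y = 1 →
      biquadratic c (fun k => (x k : ℝ)) (fun k => (y k : ℝ)) = 0)
    (x y : Fin (2 * g) → ℝ) : biquadratic c x y = 0 := by
  let X : Fin (2 * g) → MvPolynomial (Fin (2 * g) ⊕ Fin (2 * g)) ℝ :=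
    fun k => MvPolynomial.X (Sum.inl k)
  let Y : Fin (2 * g) → MvPolynomial (Fin (2 * g) ⊕ Fin (2 * g)) ℝ :=
    fun k => MvPolynomial.X (Sum.inr k)
  let C := fun i j k l => MvPolynomial.C (σ := Fin (2 * g) ⊕ Fin (2 * g)) (c i j k l)
  let e : Fin (2 * g) := ⟨i₀.1, by have := i₀.2; omega⟩
  have hX (z) : MvPolynomial.eval z ∘ X = z ∘ Sum.inl := by ext; simp [X]
  have hY (z) : MvPolynomial.eval z ∘ Y = z ∘ Sum.inr := by ext; simp [Y]
  have hchart : biquadratic C (normalizeFst i₀ X) (normalizeSnd i₀ X Y) = 0 := by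
    refine MvPolynomial.funext_set (fun _ => Set.range ((↑) : ℤ → ℝ))
      (fun _ => Set.infinite_range_of_injective Int.cast_injective) fun z hz => ?_
    choose w hw using fun k => hz k trivial
    obtain rfl : (Int.castRingHom ℝ) ∘ w = z := funext hw
    rw [map_biquadratic, map_comp_normalizeFst, map_comp_normalizeSnd, hX, hY,
      Function.comp_assoc, Function.comp_assoc, ← map_comp_normalizeFst, ← map_comp_normalizeSnd]
    simpa [C, Function.comp_def] using
      h _ _ (symplecticSum_normalize i₀ (w ∘ Sum.inl) (w ∘ Sum.inr))
  have hreal (x y : Fin (2 * g) → ℝ) :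
      biquadratic c (normalizeFst i₀ x) (normalizeSnd i₀ x y) = 0 := by
    have := congrArg (MvPolynomial.eval (Sum.elim x y)) hchart
    rw [map_biquadratic, map_comp_normalizeFst, map_comp_normalizeSnd, hX, hY] at this
    simpa [C] using this
  have hopen (x y : Fin (2 * g) → ℝ) (hx : x e ≠ 0) (hxy : symplecticSum g x y ≠ 0) :
      biquadratic c x y = 0 := by
    have h1 : ((x e)⁻¹ • x) e = 1 := by simp [hx]
    have h2 : symplecticSum g ((x e)⁻¹ • x) ((x e / symplecticSum g x y) • y) = 1 := by
      rw [symplecticSum_smul_smul]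
      field_simp
    have h3 := hreal ((x e)⁻¹ • x) ((x e / symplecticSum g x y) • y)
    rw [normalizeFst_eq_self h1, normalizeSnd_eq_self h1 h2, biquadratic_smul_smul] at h3
    simpa [hx, hxy] using h3
  have hprod : X e * symplecticSum g X Y * biquadratic C X Y = 0 := by
    refine MvPolynomial.funext fun z => ?_
    rw [map_mul, map_mul, map_biquadratic, map_symplecticSum, hX, hY]
    by_cases hx : z (Sum.inl e) = 0
    · simp [X, hx]
    by_cases hxy : symplecticSum g (z ∘ Sum.inl) (z ∘ Sum.inr) = 0
    · simp [hxy]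
    · simp [C, hopen _ _ hx hxy]
  have hω : symplecticSum g X Y ≠ 0 := by
    intro h0
    have h1 := congrArg (MvPolynomial.eval (Sum.elim (normalizeFst i₀ 0) (normalizeSnd i₀ 0 0))) h0
    rw [map_symplecticSum, hX, hY, Sum.elim_comp_inl, Sum.elim_comp_inr,
      symplecticSum_normalize] at h1
    simp at h1
  have hQ : biquadratic C X Y = 0 :=
    (mul_eq_zero.1 hprod).resolve_left (mul_ne_zero (MvPolynomial.X_ne_zero _) hω)
  have := congrArg (MvPolynomial.eval (Sum.elim x y)) hQ
  rw [map_biquadratic, hX, hY] at this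
  simpa [C] using this

end BiquadraticForm

/-- Finitely many points of a set `s`, as many as the dimension of the ambient space, suffice to
test the vanishing on `s` of every linear functional. -/
theorem exists_finite_test_set {κ α : Type*} [Fintype κ] (E : α → κ → ℝ) (s : Set α)
    (hs : s.Nonempty) {N : ℕ} (hN : Fintype.card κ ≤ N) :
    ∃ S : Fin N → α, (∀ i, S i ∈ s) ∧
      ∀ L : (κ → ℝ) →ₗ[ℝ] ℝ, (∀ i, L (E (S i)) = 0) → ∀ a ∈ s, L (E a) = 0 := by
  obtain ⟨a₀, ha₀⟩ := hs
  obtain ⟨f, hf, hspan, -⟩ := Submodule.exists_fun_fin_finrank_span_eq ℝ (E '' s)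
  choose p hps hpE using hf
  have hd : Module.finrank ℝ (Submodule.span ℝ (E '' s)) ≤ N :=
    ((Submodule.finrank_le _).trans_eq (Module.finrank_fintype_fun_eq_card ℝ)).trans hN
  refine ⟨fun i => if h : i.1 < _ then p ⟨i.1, h⟩ else a₀, fun i => ?_, fun L hL a ha => ?_⟩
  · dsimp only
    split_ifs
    exacts [hps _, ha₀]
  · have hker : Submodule.span ℝ (E '' s) ≤ LinearMap.ker L := by
      rw [← hspan, Submodule.span_le]
      rintro _ ⟨j, rfl⟩
      simpa [hpE] using hL ⟨j.1, j.2.trans_le hd⟩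
    exact hker (Submodule.subset_span ⟨a, ha, rfl⟩)

theorem Quv_swap (g : ℕ) (u v : (Fin (2 * g) → ℝ) →ₗ[ℝ] (Fin 3 → ℝ)) (x y : Fin (2 * g) → ℝ) :
    Quv g u v y x = Quv g u v x y := by
  simp only [Quv, cross_apply, dotProduct, Fin.sum_univ_three, Pi.sub_apply, cons_val]
  ring

/-- The coefficients of `Quv` as a form of degree `(2, 2)`. -/
def quvCoeff (g : ℕ) (u v : (Fin (2 * g) → ℝ) →ₗ[ℝ] (Fin 3 → ℝ)) (i j k l : Fin (2 * g)) : ℝ :=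
  (crossProduct (u (Pi.single j 1)) (u (Pi.single l 1))) ⬝ᵥ
    (crossProduct (u (Pi.single i 1)) (v (Pi.single k 1)) -
      crossProduct (u (Pi.single k 1)) (v (Pi.single i 1)))

theorem Quv_eq_biquadratic (g : ℕ) (u v : (Fin (2 * g) → ℝ) →ₗ[ℝ] (Fin 3 → ℝ))
    (x y : Fin (2 * g) → ℝ) : Quv g u v x y = biquadratic (quvCoeff g u v) x y := by
  have hlin (w : (Fin (2 * g) → ℝ) →ₗ[ℝ] (Fin 3 → ℝ)) (x) :
      w x = ∑ i, x i • w (Pi.single i 1) := by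
    conv_lhs => rw [pi_eq_sum_univ' x, map_sum]
    simp only [map_smul]
  have hcross (z w : Fin (2 * g) → ℝ) (a b : Fin (2 * g) → Fin 3 → ℝ) :
      crossProduct (∑ i, z i • a i) (∑ j, w j • b j) =
        ∑ i, ∑ j, (z i * w j) • crossProduct (a i) (b j) := by
    simp only [map_sum, LinearMap.sum_apply, map_smul, LinearMap.smul_apply, Finset.smul_sum,
      smul_smul]
    rw [Finset.sum_comm]
    simp only [mul_comm (w _)]
  have hrhs : crossProduct (u x) (v y) - crossProduct (u y) (v x) =
      ∑ j, ∑ l, (x j * y l) • (crossProduct (u (Pi.single j 1)) (v (Pi.single l 1)) -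
        crossProduct (u (Pi.single l 1)) (v (Pi.single j 1))) := by
    rw [hlin u x, hlin u y, hlin v x, hlin v y, hcross, hcross]
    rw [Finset.sum_comm (f := fun i j => (y i * x j) • _), ← Finset.sum_sub_distrib]
    refine Finset.sum_congr rfl fun j _ => ?_
    rw [← Finset.sum_sub_distrib]
    exact Finset.sum_congr rfl fun l _ => by rw [smul_sub, mul_comm (y l)]
  rw [Quv, hrhs, hlin u x, hlin u y, hcross]
  simp only [sum_dotProduct, dotProduct_sum, smul_dotProduct, dotProduct_smul, biquadratic,
    smul_eq_mul]
  refine Finset.sum_congr rfl fun i _ => ?_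
  simp only [Finset.mul_sum]
  rw [Finset.sum_comm]
  refine Finset.sum_congr rfl fun j _ => Finset.sum_congr rfl fun k _ =>
    Finset.sum_congr rfl fun l _ => ?_
  rw [quvCoeff]
  ring

/-- `Quv` factors linearly through `pairMonomials`. -/
theorem exists_linear_Quv (g : ℕ) (u v : (Fin (2 * g) → ℝ) →ₗ[ℝ] (Fin 3 → ℝ)) :
    ∃ L : (Sym2 (Sym2 (Fin (2 * g))) → ℝ) →ₗ[ℝ] ℝ,
      ∀ x y, L (pairMonomials x y) = Quv g u v x y := by
  refine ⟨(1 / 2 : ℝ) • ∑ i, ∑ j, ∑ k, ∑ l,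
    quvCoeff g u v i j k l • LinearMap.proj s(s(i, j), s(k, l)), fun x y => ?_⟩
  have h := biquadratic_add_swap (quvCoeff g u v) x y
  rw [← Quv_eq_biquadratic, ← Quv_eq_biquadratic, Quv_swap g u v x y] at h
  simp only [LinearMap.smul_apply, LinearMap.sum_apply, LinearMap.proj_apply, smul_eq_mul, ← h]
  ring

theorem exists_eq_crossProduct_of_Quv_eq_zero (g : ℕ)
    (u v : (Fin (2 * g) → ℝ) →ₗ[ℝ] (Fin 3 → ℝ)) (hu : Function.Surjective u)
    (hQ : ∀ x y, Quv g u v x y = 0) :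
    ∃ ξ : Fin 3 → ℝ, ∀ x, v x = crossProduct ξ (u x) := by
  obtain ⟨a, ha⟩ := hu ![1, 0, 0]
  obtain ⟨b, hb⟩ := hu ![0, 1, 0]
  obtain ⟨c, hc⟩ := hu ![0, 0, 1]
  have hab := hQ a b
  have hbc := hQ b c
  have hca := hQ c a
  have habc := hQ (a + b) c
  have hbca := hQ (b + c) a
  have hcab := hQ (c + a) b
  simp [Quv, ha, hb, hc, cross_apply, dotProduct, Fin.sum_univ_three] at hab hbc hca habc hbca hcab
  have hker (k) (hk : u k = 0) : v k = 0 := by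
    have h0 := hQ (b + k) a
    have h1 := hQ (c + k) b
    have h2 := hQ (a + k) c
    simp [Quv, ha, hb, hc, hk, cross_apply, dotProduct, Fin.sum_univ_three] at h0 h1 h2
    ext i
    fin_cases i <;> simp <;> linarith
  refine ⟨![v b 2, -v a 2, v a 1], fun x => ?_⟩
  have hx : v (x - (u x 0 • a + u x 1 • b + u x 2 • c)) = 0 := by
    apply hker
    ext i
    fin_cases i <;> simp [ha, hb, hc]
  rw [map_sub, sub_eq_zero] at hx
  have haa : v a 0 = 0 := by linarith
  have hbb : v b 1 = 0 := by linarith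
  have hcc : v c 2 = 0 := by linarith
  have hba : v b 0 = -v a 1 := by linarith
  have hcb : v c 1 = -v b 2 := by linarith
  have hac : v c 0 = -v a 2 := by linarith
  rw [hx]
  ext i
  fin_cases i <;> simp [cross_apply, haa, hbb, hcc, hba, hcb, hac] <;> ring

/-- Proposition 4.1 (linear-algebraic content): there is a set of
`N = g(2g+1)(2g²+g+1)/2` integral symplectic pairs `S` such that for all `u, v` with `u`
surjective, `[u∧u] = 0`, `[u∧v] = 0` and `Q_{u,v}` vanishing on `S`, one has `v = [ξ, u]`
for some `ξ ∈ ℝ³`. -/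
theorem stmt7 (g : ℕ) (hg : 2 ≤ g) :
    ∃ S : Fin (g * (2 * g + 1) * (2 * g ^ 2 + g + 1) / 2) →
        (Fin (2 * g) → ℤ) × (Fin (2 * g) → ℤ),
      (∀ i, omegaInt g (S i).1 (S i).2 = 1) ∧
      ∀ u v : (Fin (2 * g) → ℝ) →ₗ[ℝ] (Fin 3 → ℝ),
        Function.Surjective u →
        wedgeBracket g u u = 0 →
        wedgeBracket g u v = 0 →
        (∀ i, Quv g u v (fun k => ((S i).1 k : ℝ)) (fun k => ((S i).2 k : ℝ)) = 0) →
        ∃ ξ : Fin 3 → ℝ, ∀ x : Fin (2 * g) → ℝ, v x = crossProduct ξ (u x) := by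
  have hcard : Fintype.card (Sym2 (Sym2 (Fin (2 * g)))) =
      g * (2 * g + 1) * (2 * g ^ 2 + g + 1) / 2 := by
    have h : (2 * g + 1).choose 2 = g * (2 * g + 1) := by
      rw [Nat.choose_two_right, Nat.add_sub_cancel, mul_left_comm, Nat.mul_div_cancel_left _ two_pos,
        mul_comm]
    rw [Sym2.card, Sym2.card, Fintype.card_fin, h, Nat.choose_two_right, Nat.add_sub_cancel]
    congr 1
    ring
  let i₀ : Fin g := ⟨0, by omega⟩
  obtain ⟨S, hS, hSL⟩ := exists_finite_test_set
    (fun p : (Fin (2 * g) → ℤ) × (Fin (2 * g) → ℤ) =>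
      pairMonomials (fun k => (p.1 k : ℝ)) (fun k => (p.2 k : ℝ)))
    {p | symplecticSum g p.1 p.2 = 1}
    ⟨(normalizeFst i₀ 0, normalizeSnd i₀ 0 0), symplecticSum_normalize i₀ 0 0⟩ hcard.le
  refine ⟨S, hS, fun u v hu _ _ hQ => exists_eq_crossProduct_of_Quv_eq_zero g u v hu ?_⟩
  obtain ⟨L, hL⟩ := exists_linear_Quv g u v
  intro x y
  rw [Quv_eq_biquadratic]
  refine biquadratic_eq_zero_of_integral i₀ _ (fun x y hxy => ?_) x y
  rw [← Quv_eq_biquadratic, ← hL]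
  exact hSL L (fun i => (hL _ _).trans (hQ i)) (x, y) hxy
end
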